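/- There exists a universal constant C > 0 such that for every integer k ≥ 2, every real ε > 0, and every connected weighted graph H on n vertices whose weighted girth is strictly greater than (2k−1)(1+ε) + 1, the total edge weight of H satisfies w(H) ≤ C · w(MST(H)) · n^{1/k} · (1 + k/(ε^{1+1/k} · log k)). -/

import Mathlib

open SimpleGraph

/-- The total weight of a graph: the sum of the weights of all its edges. -/
noncomputable def totalWeight {V : Type} [Fintype V] (G : SimpleGraph V)
    (w : Sym2 V → NNReal) : ℝ :=
  ∑ e ∈ G.edgeSet.toFinite.toFinset, (w e : ℝ)

/-- The weight of a minimum spanning tree of a connected graph `G`. -/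
noncomputable def mstWeight {V : Type} [Fintype V] (G : SimpleGraph V)
    (w : Sym2 V → NNReal) : ℝ :=
  sInf {x | ∃ T : SimpleGraph V, T ≤ G ∧ T.IsTree ∧ x = totalWeight T w}

section Moore

variable {D N : Type*}

/-- Two consecutive darts of a non-backtracking walk. -/
def NonBacktracking (src tgt : D → N) (inv : D → D) (x y : D) : Prop :=
  tgt x = src y ∧ y ≠ inv x

/-- There are no closed walks, non-backtracking except possibly at the base point, with at least
one and at most `g` darts. -/
def NoShortClosedWalk (src tgt : D → N) (inv : D → D) (g : ℕ) : Prop :=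
  ∀ (x : D) (l : List D), (x :: l).length ≤ g → (x :: l).IsChain (NonBacktracking src tgt inv) →
    tgt ((x :: l).getLast (by simp)) ≠ src x

open Classical in
/-- The darts in `S` ending a non-backtracking walk of `i + 1` darts of `S` starting at `a`. -/
noncomputable def reachableDarts (src tgt : D → N) (inv : D → D) (S : Finset D) (a : N) :
    ℕ → Finset D
  | 0 => S.filter fun d => src d = a
  | i + 1 => S.filter fun d =>
      ∃ c ∈ reachableDarts src tgt inv S a i, NonBacktracking src tgt inv c d

variable {src tgt : D → N} {inv : D → D}

lemma exists_chain_of_mem_reachableDarts {S : Finset D} {a : N} {i : ℕ} {d : D}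
    (hd : d ∈ reachableDarts src tgt inv S a i) :
    ∃ (x : D) (l : List D), (x :: l).length = i + 1 ∧
      (x :: l).IsChain (NonBacktracking src tgt inv) ∧ src x = a ∧
      (x :: l).getLast (by simp) = d := by
  induction i generalizing d with
  | zero =>
    simp only [reachableDarts, Finset.mem_filter] at hd
    exact ⟨d, [], by simp, by simp, hd.2, by simp⟩
  | succ i ih =>
    simp only [reachableDarts, Finset.mem_filter] at hd
    obtain ⟨-, c, hc, hcd⟩ := hd
    obtain ⟨x, l, hlen, hchain, hx, hlast⟩ := ih hc
    refine ⟨x, l ++ [d], by simpa using hlen, ?_, hx, by simp⟩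
    rw [← List.cons_append, List.isChain_append]
    refine ⟨hchain, by simp, ?_⟩
    intro y hy z hz
    rw [List.getLast?_eq_getLast_of_ne_nil (by simp)] at hy
    simp only [Option.mem_def, Option.some.injEq, List.head?_cons] at hy hz
    rw [← hy, ← hz, hlast]
    exact hcd

lemma tgt_injOn_reachableDarts (hinv : ∀ d, inv (inv d) = d) (hsrc : ∀ d, src (inv d) = tgt d)
    {g : ℕ} (hg : NoShortClosedWalk src tgt inv g) {S : Finset D} {a : N} {i : ℕ}
    (hi : 2 * (i + 1) ≤ g) :
    Set.InjOn tgt (reachableDarts src tgt inv S a i) := by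
  have htgt : ∀ d, tgt (inv d) = src d := fun d => by rw [← hsrc, hinv]
  intro d hd e he hde
  by_contra hne
  obtain ⟨x, l, hlen, hchain, hx, hlast⟩ := exists_chain_of_mem_reachableDarts hd
  obtain ⟨y, m, hlen', hchain', hy, hlast'⟩ := exists_chain_of_mem_reachableDarts he
  refine hg x (l ++ ((y :: m).reverse.map inv)) ?_ ?_ ?_
  · simp at hlen hlen' ⊢
    omega
  · rw [← List.cons_append, List.isChain_append]
    refine ⟨hchain, ?_, ?_⟩
    · rw [List.isChain_map, List.isChain_reverse]
      refine hchain'.imp fun p q hpq => ⟨?_, ?_⟩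
      · rw [htgt, hsrc, hpq.1]
      · rw [hinv]
        exact fun h => hpq.2 h.symm
    · intro p hp q hq
      rw [List.getLast?_eq_getLast_of_ne_nil (by simp)] at hp
      rw [List.head?_map, List.head?_reverse, List.getLast?_eq_getLast_of_ne_nil (by simp)] at hq
      simp only [Option.mem_def, Option.some.injEq, Option.map_some] at hp hq
      rw [← hp, ← hq, hlast, hlast']
      refine ⟨by rw [hsrc, hde], fun h => hne ?_⟩
      rw [← hinv d, ← h, hinv]
  · have : (x :: (l ++ (y :: m).reverse.map inv)).getLast (by simp) = inv y := by simp
    rw [this, htgt, hx, hy]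

open Classical in
lemma card_reachableDarts_succ (hinv : ∀ d, inv (inv d) = d) (hsrc : ∀ d, src (inv d) = tgt d)
    {g : ℕ} (hg : NoShortClosedWalk src tgt inv g) {A : Finset N} {S : Finset D}
    (hSA : ∀ d ∈ S, tgt d ∈ A)
    {t : ℝ} (ht : ∀ a ∈ A, t ≤ (S.filter fun d => src d = a).card) {a : N} {i : ℕ}
    (hi : 2 * (i + 1) ≤ g) :
    (t - 1) * (reachableDarts src tgt inv S a i).card ≤
      (reachableDarts src tgt inv S a (i + 1)).card := by
  have hsub : ∀ c ∈ reachableDarts src tgt inv S a i, c ∈ S := by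
    intro c hc
    cases i <;> exact (Finset.mem_filter.1 hc).1
  have hunion : reachableDarts src tgt inv S a (i + 1) =
      (reachableDarts src tgt inv S a i).biUnion
        fun c => (S.filter fun d => src d = tgt c).erase (inv c) := by
    ext d
    simp only [reachableDarts, Finset.mem_filter, Finset.mem_biUnion, Finset.mem_erase]
    constructor
    · rintro ⟨hd, c, hc, h1, h2⟩
      exact ⟨c, hc, h2, hd, h1.symm⟩
    · rintro ⟨c, hc, h2, hd, h1⟩
      exact ⟨hd, c, hc, h1.symm, h2⟩
  rw [hunion, Finset.card_biUnion]
  · push_cast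
    rw [mul_comm, ← nsmul_eq_mul]
    refine Finset.card_nsmul_le_sum _ _ _ fun c hc => ?_
    have h1 := ht (tgt c) (hSA c (hsub c hc))
    have h2 := Finset.pred_card_le_card_erase (s := S.filter fun d => src d = tgt c) (a := inv c)
    have h3 : (S.filter fun d => src d = tgt c).card ≤
      ((S.filter fun d => src d = tgt c).erase (inv c)).card + 1 := by omega
    have h4 : ((S.filter fun d => src d = tgt c).card : ℝ) ≤
      ((S.filter fun d => src d = tgt c).erase (inv c)).card + 1 := by exact_mod_cast h3
    linarith
  · intro c hc e he hce
    rw [Function.onFun, Finset.disjoint_left]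
    intro d hd hd'
    simp only [Finset.mem_erase, Finset.mem_filter] at hd hd'
    exact hce (tgt_injOn_reachableDarts hinv hsrc hg hi hc he (hd.2.2.symm.trans hd'.2.2))

open Classical in
lemma exists_core [Fintype D] [Fintype N] (hinv : ∀ d, inv (inv d) = d)
    (hsrc : ∀ d, src (inv d) = tgt d) {t : ℝ}
    (h : 2 * t * Fintype.card N < Fintype.card D) :
    ∃ A : Finset N, A.Nonempty ∧ ∀ a ∈ A,
      t ≤ ((Finset.univ.filter fun d => src d ∈ A ∧ tgt d ∈ A).filter
        fun d => src d = a).card := by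
  let inside : Finset N → Finset D := fun A => Finset.univ.filter fun d => src d ∈ A ∧ tgt d ∈ A
  obtain ⟨A, -, hA⟩ := Finset.exists_max_image (Finset.univ : Finset (Finset N))
    (fun A => ((inside A).card : ℝ) - 2 * t * A.card) ⟨∅, by simp⟩
  refine ⟨A, ?_, ?_⟩
  · by_contra hne
    rw [Finset.not_nonempty_iff_eq_empty] at hne
    have := hA Finset.univ (by simp)
    simp [hne, inside] at this
    linarith
  · intro a ha
    have h1 := hA (A.erase a) (by simp)
    have h2 : ((A.erase a).card : ℝ) = A.card - 1 := by
      rw [Finset.card_erase_of_mem ha, Nat.cast_sub (Finset.card_pos.2 ⟨a, ha⟩)]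
      simp
    have h3 : inside A ⊆ inside (A.erase a) ∪ ((inside A).filter (fun d => src d = a) ∪
        ((inside A).filter (fun d => src d = a)).image inv) := by
      intro d hd
      simp only [inside, Finset.mem_union, Finset.mem_filter, Finset.mem_univ, true_and,
        Finset.mem_erase, Finset.mem_image] at hd ⊢
      by_cases h5 : src d = a
      · exact Or.inr (Or.inl ⟨hd, h5⟩)
      by_cases h6 : tgt d = a
      · refine Or.inr (Or.inr ⟨inv d, ⟨⟨?_, ?_⟩, ?_⟩, hinv d⟩)
        · rw [hsrc]; exact hd.2
        · rw [← hsrc, hinv]; exact hd.1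
        · rw [hsrc, h6]
      · exact Or.inl ⟨⟨h5, hd.1⟩, h6, hd.2⟩
    have h4 : (inside A).card ≤ (inside (A.erase a)).card +
        2 * ((inside A).filter (fun d => src d = a)).card := by
      refine (Finset.card_le_card h3).trans ((Finset.card_union_le _ _).trans ?_)
      have h5 := Finset.card_union_le ((inside A).filter (fun d => src d = a))
        (((inside A).filter (fun d => src d = a)).image inv)
      have h6 := Finset.card_image_le (s := (inside A).filter (fun d => src d = a)) (f := inv)
      omega
    have h5 : ((inside A).card : ℝ) ≤ (inside (A.erase a)).card +
        2 * ((inside A).filter (fun d => src d = a)).card := by exact_mod_cast h4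
    simp only [h2] at h1
    change t ≤ ((inside A).filter (fun d => src d = a)).card
    linarith

/-- The Moore bound, for multigraphs presented by their darts. -/
theorem card_darts_le [Fintype D] [Fintype N] (hinv : ∀ d, inv (inv d) = d)
    (hsrc : ∀ d, src (inv d) = tgt d) {k : ℕ} (hk : 0 < k)
    (hg : NoShortClosedWalk src tgt inv (2 * k)) :
    (Fintype.card D : ℝ) ≤
      2 * (1 + (Fintype.card N : ℝ) ^ ((1 : ℝ) / (k : ℝ))) * Fintype.card N := by
  classical
  by_contra! hcon
  set r : ℝ := (Fintype.card N : ℝ) ^ ((1 : ℝ) / (k : ℝ)) with hr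
  obtain ⟨A, ⟨a, ha⟩, hA⟩ := exists_core hinv hsrc hcon
  set S : Finset D := Finset.univ.filter fun d => src d ∈ A ∧ tgt d ∈ A with hS
  have hr0 : 0 ≤ r := by positivity
  have hrk : r ^ k = Fintype.card N := by
    rw [hr, one_div, Real.rpow_inv_natCast_pow (by positivity) hk.ne']
  have hcard : ∀ i, i < k → (1 + r) * r ^ i ≤ (reachableDarts src tgt inv S a i).card := by
    intro i hi
    induction i with
    | zero => simpa [reachableDarts] using hA a ha
    | succ i ih =>
      have h1 := ih (by omega)
      have h2 := card_reachableDarts_succ hinv hsrc hg (S := S) (A := A) (t := 1 + r) (a := a)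
        (i := i) (fun d hd => (Finset.mem_filter.1 hd).2.2) hA (by omega)
      refine le_trans ?_ h2
      have := mul_le_mul_of_nonneg_left h1 hr0
      rw [pow_succ]
      linarith
  have h1 := hcard (k - 1) (by omega)
  have h2 : (reachableDarts src tgt inv S a (k - 1)).card ≤ Fintype.card N :=
    Finset.card_le_card_of_injOn tgt (fun _ _ => Finset.mem_univ _)
      (tgt_injOn_reachableDarts hinv hsrc hg (by omega))
  have h3 : ((reachableDarts src tgt inv S a (k - 1)).card : ℝ) ≤ Fintype.card N := by
    exact_mod_cast h2
  have h4 : r * r ^ (k - 1) = r ^ k := by rw [← pow_succ', Nat.sub_add_cancel hk]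
  have h5 : 0 < Fintype.card N := Fintype.card_pos_iff.2 ⟨a⟩
  have h6 : 0 < r := by
    rw [hr]
    positivity
  have h7 : 0 < r ^ (k - 1) := by positivity
  nlinarith

end Moore

section Walks

variable {V : Type} {H T : SimpleGraph V} {w : Sym2 V → NNReal}

/-- The weight of a walk, edges counted with multiplicity. -/
noncomputable def walkWeight (w : Sym2 V → NNReal) {G : SimpleGraph V} {u v : V}
    (p : G.Walk u v) : ℝ :=
  (p.edges.map fun e => (w e : ℝ)).sum

lemma walkWeight_append {G : SimpleGraph V} {a b c : V} (p : G.Walk a b) (q : G.Walk b c) :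
    walkWeight w (p.append q) = walkWeight w p + walkWeight w q := by
  simp [walkWeight, Walk.edges_append]

lemma walkWeight_reverse {G : SimpleGraph V} {a b : V} (p : G.Walk a b) :
    walkWeight w p.reverse = walkWeight w p := by
  simp [walkWeight, Walk.edges_reverse]

/-- Every cycle of `H` weighs more than `γ` times each of its edges. -/
def WeightedGirthGT (H : SimpleGraph V) (w : Sym2 V → NNReal) (γ : ℝ) : Prop :=
  ∀ (v : V) (p : H.Walk v v), p.IsCycle → ∀ e ∈ p.edges, γ * (w e : ℝ) < walkWeight w p

/-- There is a walk in `H` from `a` to `b` of weight at most `c` that avoids the edge `e`. -/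
def JoinedAvoiding (H : SimpleGraph V) (w : Sym2 V → NNReal) (e : Sym2 V) (a b : V) (c : ℝ) :
    Prop :=
  ∃ q : H.Walk a b, e ∉ q.edges ∧ walkWeight w q ≤ c

namespace JoinedAvoiding

variable {e : Sym2 V} {a b c : V} {x y : ℝ}

lemma trans (h₁ : JoinedAvoiding H w e a b x) (h₂ : JoinedAvoiding H w e b c y) :
    JoinedAvoiding H w e a c (x + y) := by
  obtain ⟨p, hp, hpx⟩ := h₁
  obtain ⟨q, hq, hqy⟩ := h₂
  refine ⟨p.append q, by simp [Walk.edges_append, hp, hq], ?_⟩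
  rw [walkWeight_append]
  exact add_le_add hpx hqy

lemma of_adj (h : H.Adj a b) (he : s(a, b) ≠ e) :
    JoinedAvoiding H w e a b (w s(a, b)) :=
  ⟨h.toWalk, by simpa using he.symm, by simp [walkWeight]⟩

lemma of_walk (hTH : T ≤ H) (he : e ∉ T.edgeSet) (p : T.Walk a b) (hp : walkWeight w p ≤ x) :
    JoinedAvoiding H w e a b x := by
  refine ⟨p.mapLe hTH, ?_, ?_⟩
  · rw [Walk.edges_mapLe_eq_edges]
    exact fun h => he (p.edges_subset_edgeSet h)
  · simpa only [walkWeight, Walk.edges_mapLe_eq_edges] using hp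

end JoinedAvoiding

lemma WeightedGirthGT.lt_of_joinedAvoiding {γ : ℝ} (hg : WeightedGirthGT H w γ) {u v : V}
    (huv : H.Adj u v) {c : ℝ} (h : JoinedAvoiding H w s(u, v) v u c) :
    γ * (w s(u, v) : ℝ) < w s(u, v) + c := by
  classical
  obtain ⟨q, hq, hqc⟩ := h
  have hsub := q.edges_bypass_subset_edges
  have hcyc : (Walk.cons huv q.bypass).IsCycle :=
    (Walk.cons_isCycle_iff _ _).2 ⟨q.bypass_isPath, fun h => hq (hsub h)⟩
  have h1 := hg u _ hcyc s(u, v) (by simp)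
  have h2 : walkWeight w q.bypass ≤ walkWeight w q := by
    refine List.Sublist.sum_le_sum (q.edges_bypass_sublist_edges.map _) ?_
    intro x hx
    obtain ⟨e, -, rfl⟩ := List.mem_map.1 hx
    positivity
  have h3 : walkWeight w (Walk.cons huv q.bypass) = w s(u, v) + walkWeight w q.bypass := by
    simp [walkWeight]
  linarith

lemma exists_line_embedding_of_finset [Fintype V] (hT : T.Connected) (n : ℕ) (hn : 1 ≤ n)
    (hnV : n ≤ Fintype.card V) :
    ∃ S : Finset V, S.card = n ∧ ∃ F : Finset (Sym2 V), ↑F ⊆ T.edgeSet ∧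
      (∀ e ∈ F, ∀ v ∈ e, v ∈ S) ∧ ∃ f : V → ℝ,
      (∀ v ∈ S, 0 ≤ f v ∧ f v ≤ 2 * ∑ e ∈ F, (w e : ℝ)) ∧
      ∀ u ∈ S, ∀ v ∈ S, ∃ p : T.Walk u v, walkWeight w p ≤ |f u - f v| := by
  classical
  induction n, hn using Nat.le_induction with
  | base =>
    obtain ⟨a⟩ := hT.nonempty
    refine ⟨{a}, by simp, ∅, by simp, by simp, fun _ => 0, by simp, ?_⟩
    intro u hu v hv
    rw [Finset.mem_singleton] at hu hv
    subst hu
    subst hv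
    exact ⟨Walk.nil, by simp [walkWeight]⟩
  | succ n hn ih =>
    obtain ⟨S, hS, F, hFT, hFS, f, hf, hwalk⟩ := ih (by omega)
    obtain ⟨a, ha⟩ : S.Nonempty := Finset.card_pos.1 (by omega)
    obtain ⟨b, hb⟩ : ∃ b, b ∉ S := by
      by_contra! hall
      have : S = Finset.univ := by ext; simp [hall]
      rw [this, Finset.card_univ] at hS
      omega
    obtain ⟨q⟩ := hT.preconnected a b
    obtain ⟨d, -, hd1, hd2⟩ := q.exists_boundary_dart (S : Set V) (by simpa) (by simpa)
    obtain ⟨⟨p, l⟩, hpl⟩ := d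
    simp only [Finset.mem_coe] at hd1 hd2
    simp only at hpl
    have hlF : s(p, l) ∉ F := fun h => hd2 (hFS _ h l (by simp))
    have hc0 : (0 : ℝ) ≤ w s(p, l) := by positivity
    set c : ℝ := (w s(p, l) : ℝ) with hc
    have hF0 : (0 : ℝ) ≤ ∑ e ∈ F, (w e : ℝ) := by positivity
    let f' : V → ℝ := fun v => if v = l then f p + c else if f v ≤ f p then f v else f v + 2 * c
    have hfl : f' l = f p + c := by simp [f']
    have hfS : ∀ v ∈ S, f' v = if f v ≤ f p then f v else f v + 2 * c := by
      intro v hv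
      have : v ≠ l := fun h => hd2 (h ▸ hv)
      simp [f', this]
    have hleaf : ∀ v ∈ S, ∃ r : T.Walk v l, walkWeight w r ≤ |f' v - f' l| := by
      intro v hv
      obtain ⟨r, hr⟩ := hwalk v hv p hd1
      refine ⟨r.append hpl.toWalk, ?_⟩
      rw [walkWeight_append, hfl, hfS v hv]
      have : walkWeight w hpl.toWalk = c := by simp [walkWeight, hc]
      rw [this]
      refine (add_le_add_left hr c).trans ?_
      split_ifs with h
      · rw [abs_of_nonpos (by linarith), abs_of_nonpos (by linarith)]
        linarith
      · rw [abs_of_nonneg (by linarith), abs_of_nonneg (by linarith)]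
        linarith
    refine ⟨insert l S, by simp [hd2, hS], insert s(p, l) F, ?_, ?_, f', ?_, ?_⟩
    · rw [Finset.coe_insert]
      exact Set.insert_subset hpl hFT
    · intro e he v hv
      rw [Finset.mem_insert] at he ⊢
      rcases he with rfl | he
      · rcases Sym2.mem_iff.1 hv with rfl | rfl
        · exact Or.inr hd1
        · exact Or.inl rfl
      · exact Or.inr (hFS e he v hv)
    · intro v hv
      rw [Finset.sum_insert hlF, ← hc]
      rw [Finset.mem_insert] at hv
      rcases hv with rfl | hv
      · rw [hfl]
        have := hf p hd1
        constructor <;> linarith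
      · rw [hfS v hv]
        have := hf v hv
        split_ifs <;> constructor <;> linarith
    · intro u hu v hv
      rw [Finset.mem_insert] at hu hv
      rcases hu with rfl | hu <;> rcases hv with rfl | hv
      · exact ⟨Walk.nil, by simp [walkWeight]⟩
      · obtain ⟨r, hr⟩ := hleaf v hv
        exact ⟨r.reverse, by rwa [walkWeight_reverse, abs_sub_comm]⟩
      · exact hleaf u hu
      · obtain ⟨r, hr⟩ := hwalk u hu v hv
        refine ⟨r, hr.trans ?_⟩
        rw [hfS u hu, hfS v hv]
        split_ifs with h1 h2 h2
        · exact le_rfl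
        · rw [abs_of_nonpos (by linarith), abs_of_nonpos (by linarith)]
          linarith
        · rw [abs_of_nonneg (by linarith), abs_of_nonneg (by linarith)]
          linarith
        · simp

/-- The depth-first tour of a connected graph `T` places its vertices on a segment of length
twice the weight of `T` without shrinking distances. -/
lemma exists_line_embedding [Fintype V] (hT : T.Connected) :
    ∃ f : V → ℝ, (∀ v, 0 ≤ f v ∧ f v ≤ 2 * totalWeight T w) ∧
      ∀ u v, ∃ p : T.Walk u v, walkWeight w p ≤ |f u - f v| := by
  have : Nonempty V := hT.nonempty
  obtain ⟨S, hS, F, hFT, -, f, hf, hwalk⟩ :=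
    exists_line_embedding_of_finset (w := w) hT (Fintype.card V) Fintype.card_pos le_rfl
  rw [Finset.card_eq_iff_eq_univ] at hS
  subst hS
  refine ⟨f, fun v => ⟨(hf v (by simp)).1, (hf v (by simp)).2.trans ?_⟩,
    fun u v => hwalk u (by simp) v (by simp)⟩
  refine mul_le_mul_of_nonneg_left ?_ zero_le_two
  refine Finset.sum_le_sum_of_subset_of_nonneg ?_ fun _ _ _ => by positivity
  intro e he
  simpa using hFT he

end Walks

section Chains

variable {V : Type} {H T : SimpleGraph V} {w : Sym2 V → NNReal}

lemma exists_append_of_not_nodup_map {α β : Type*} (f : α → β) (l : List α)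
    (hl : ¬ (l.map f).Nodup) :
    ∃ (l₁ : List α) (x : α) (l₂ : List α) (y : α) (l₃ : List α),
      l = l₁ ++ x :: (l₂ ++ y :: l₃) ∧ f x = f y ∧ ((x :: l₂).map f).Nodup := by
  induction l using List.reverseRecOn with
  | nil => simp at hl
  | append_singleton l y ih =>
    by_cases h : (l.map f).Nodup
    · have hy : f y ∈ l.map f := by
        by_contra hy
        refine hl ?_
        rw [List.map_append, List.nodup_append']
        exact ⟨h, by simp, by simpa using hy⟩
      obtain ⟨x, hx, hxy⟩ := List.mem_map.1 hy
      obtain ⟨l₁, l₂, rfl⟩ := List.append_of_mem hx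
      refine ⟨l₁, x, l₂, y, [], by simp, hxy, ?_⟩
      rw [List.map_append] at h
      exact (List.nodup_append'.1 h).2.1
    · obtain ⟨l₁, x, l₂, z, l₃, rfl, h1, h2⟩ := ih h
      exact ⟨l₁, x, l₂, z, l₃ ++ [y], by simp, h1, h2⟩

lemma exists_mem_forall_le {α : Type*} (f : α → ℝ) (l : List α) (hl : l ≠ []) :
    ∃ x ∈ l, ∀ y ∈ l, f y ≤ f x := by
  classical
  obtain ⟨x, hx, h⟩ := l.toFinset.exists_max_image f (by simpa using hl)
  exact ⟨x, by simpa using hx, fun y hy => h y (by simpa using hy)⟩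

/-- Oriented edges of `H` outside `T`, indexed by `D`, together with a relation of consecutiveness
`R`: if `R x y` then the end of `x` can be joined in `T` to the start of `y` at cost
`h x + h y`. -/
structure HopSystem (H T : SimpleGraph V) (w : Sym2 V → NNReal) (k : ℕ) (ε : ℝ) {D : Type*}
    (R : D → D → Prop) (a b : D → V) (h : D → ℝ) : Prop where
  le : T ≤ H
  adj : ∀ x, H.Adj (a x) (b x)
  not_adj : ∀ x, ¬ T.Adj (a x) (b x)
  le_self : ∀ x, h x ≤ ε / 4 * w s(a x, b x)
  le_other : ∀ x y, h x ≤ k * ε / 4 * w s(a y, b y)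
  exists_walk : ∀ x y, R x y → ∃ p : T.Walk (b x) (a y), walkWeight w p ≤ h x + h y

namespace HopSystem

variable {D : Type*} {R : D → D → Prop} {a b : D → V} {h : D → ℝ} {k : ℕ} {ε : ℝ}

/-- The cost of traversing an oriented edge, including the adjacent hops. -/
noncomputable def cost (w : Sym2 V → NNReal) (a b : D → V) (h : D → ℝ) (x : D) : ℝ :=
  w s(a x, b x) + 2 * h x

lemma joinedAvoiding_of_rel (hS : HopSystem H T w k ε R a b h) (d : D) {x y : D} (hxy : R x y) :
    JoinedAvoiding H w s(a d, b d) (b x) (a y) (h x + h y) := by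
  obtain ⟨p, hp⟩ := hS.exists_walk x y hxy
  exact .of_walk hS.le (hS.not_adj d) p hp

lemma joinedAvoiding_of_isChain (hS : HopSystem H T w k ε R a b h) (d : D) (l : List D)
    (hl : ∀ x ∈ l, s(a x, b x) ≠ s(a d, b d)) (x y : D) (hc : (x :: (l ++ [y])).IsChain R) :
    JoinedAvoiding H w s(a d, b d) (b x) (a y)
      (h x + (l.map (cost w a b h)).sum + h y) := by
  induction l generalizing x with
  | nil =>
    have : R x y := by simpa using hc
    simpa using hS.joinedAvoiding_of_rel d this
  | cons z l ih =>
    rw [List.cons_append, List.isChain_cons_cons] at hc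
    have h1 := hS.joinedAvoiding_of_rel d hc.1
    have h2 := JoinedAvoiding.of_adj (w := w) (hS.adj z) (hl z (by simp))
    have h3 := ih (fun x hx => hl x (by simp [hx])) z hc.2
    convert (h1.trans h2).trans h3 using 1
    simp only [List.map_cons, List.sum_cons, cost]
    ring

lemma sum_cost_le (hS : HopSystem H T w k ε R a b h) (d : D) (l : List D)
    (hd : ∀ x ∈ l, (w s(a x, b x) : ℝ) ≤ w s(a d, b d)) (hε : 0 ≤ ε) {m : ℕ}
    (hm : l.length ≤ m) :
    (l.map (cost w a b h)).sum ≤ m * ((1 + ε / 2) * w s(a d, b d)) := by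
  have h1 : (l.map (cost w a b h)).sum ≤
      (l.map (cost w a b h)).length • ((1 + ε / 2) * (w s(a d, b d) : ℝ)) := by
    refine List.sum_le_card_nsmul _ _ fun y hy => ?_
    obtain ⟨x, hx, rfl⟩ := List.mem_map.1 hy
    have h2 := hS.le_self x
    have h3 := hd x hx
    simp only [cost]
    nlinarith
  refine h1.trans ?_
  rw [List.length_map, nsmul_eq_mul]
  gcongr

lemma chain_false_of_start_eq (hS : HopSystem H T w k ε R a b h) (hk : 2 ≤ k) (hε : 0 < ε)
    (hg : WeightedGirthGT H w ((2 * (k : ℝ) - 1) * (1 + ε) + 1)) (x y : D) (l : List D)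
    (hc : (x :: (l ++ [y])).IsChain R) (hxy : a x = a y) (hyx : h y = h x)
    (hnd : ((x :: l).map fun z => s(a z, b z)).Nodup) (hlen : l.length + 1 ≤ 2 * k) : False := by
  obtain ⟨d, hd, hmax⟩ := exists_mem_forall_le (fun z => (w s(a z, b z) : ℝ)) (x :: l) (by simp)
  have hk' : (2 : ℝ) ≤ k := by exact_mod_cast hk
  have hw0 : (0 : ℝ) ≤ w s(a d, b d) := by positivity
  have hself := hS.le_self d
  have hm : ((2 * k - 1 : ℕ) : ℝ) = 2 * k - 1 := by
    rw [Nat.cast_sub (by omega)]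
    push_cast
    ring
  obtain ⟨m, hmlen, hmw, hjoin⟩ : ∃ m : List D, m.length ≤ 2 * k - 1 ∧
      (∀ z ∈ m, (w s(a z, b z) : ℝ) ≤ w s(a d, b d)) ∧
      JoinedAvoiding H w s(a d, b d) (b d) (a d) (2 * h d + (m.map (cost w a b h)).sum) := by
    rcases List.mem_cons.1 hd with rfl | hdl
    · refine ⟨l, by omega, fun z hz => hmax z (by simp [hz]), ?_⟩
      have h1 := hS.joinedAvoiding_of_isChain d l (fun z hz hzd => ?_) d y hc
      · rw [← hxy, hyx] at h1
        convert h1 using 1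
        ring
      · rw [List.map_cons, List.nodup_cons] at hnd
        exact hnd.1 (List.mem_map.2 ⟨z, hz, hzd⟩)
    · obtain ⟨l₁, l₂, rfl⟩ := List.append_of_mem hdl
      have hnd' : (((x :: l₁) ++ d :: l₂).map fun z => s(a z, b z)).Nodup := by simpa using hnd
      rw [List.map_append, List.nodup_append'] at hnd'
      obtain ⟨-, hnd2, hdisj⟩ := hnd'
      have hne1 : ∀ z ∈ x :: l₁, s(a z, b z) ≠ s(a d, b d) := fun z hz hzd =>
        hdisj (List.mem_map.2 ⟨z, hz, hzd⟩) (by simp)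
      have hne2 : ∀ z ∈ l₂, s(a z, b z) ≠ s(a d, b d) := fun z hz hzd => by
        rw [List.map_cons, List.nodup_cons] at hnd2
        exact hnd2.1 (List.mem_map.2 ⟨z, hz, hzd⟩)
      have hc' : (x :: (l₁ ++ d :: (l₂ ++ [y]))).IsChain R := by simpa using hc
      rw [← List.cons_append, List.isChain_split] at hc'
      have h1 := hS.joinedAvoiding_of_isChain d l₁ (fun z hz => hne1 z (by simp [hz])) x d hc'.1
      have h2 := hS.joinedAvoiding_of_isChain d l₂ hne2 d y hc'.2
      have h3 := JoinedAvoiding.of_adj (w := w) (hS.adj x) (hne1 x (by simp))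
      rw [← hxy] at h2
      refine ⟨x :: (l₁ ++ l₂), ?_, fun z hz => hmax z ?_, ?_⟩
      · simp at hlen ⊢
        omega
      · simp at hz ⊢
        tauto
      · convert (h2.trans h3).trans h1 using 1
        simp only [List.map_cons, List.map_append, List.sum_cons, List.sum_append, cost, hyx]
        ring
  have h1 := hg.lt_of_joinedAvoiding (hS.adj d) hjoin
  have h2 := hS.sum_cost_le d m hmw hε.le hmlen
  rw [hm] at h2
  have h3 : 0 ≤ (k - 1 : ℝ) * (ε * w s(a d, b d)) := mul_nonneg (by linarith) (by positivity)
  nlinarith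

lemma chain_false_of_end_eq_start (hS : HopSystem H T w k ε R a b h) (hk : 2 ≤ k) (hε : 0 < ε)
    (hg : WeightedGirthGT H w ((2 * (k : ℝ) - 1) * (1 + ε) + 1)) (x y : D) (l : List D)
    (hc : (x :: (l ++ [y])).IsChain R) (hxy : b x = a y) (hl : l ≠ [])
    (hnd : (l.map fun z => s(a z, b z)).Nodup) (hlen : l.length ≤ 2 * k) : False := by
  obtain ⟨d, hd, hmax⟩ := exists_mem_forall_le (fun z => (w s(a z, b z) : ℝ)) l hl
  have hk' : (2 : ℝ) ≤ k := by exact_mod_cast hk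
  have hw0 : (0 : ℝ) ≤ w s(a d, b d) := by positivity
  have hself := hS.le_self d
  have hx := hS.le_other x d
  have hy := hS.le_other y d
  have hm : ((2 * k - 1 : ℕ) : ℝ) = 2 * k - 1 := by
    rw [Nat.cast_sub (by omega)]
    push_cast
    ring
  obtain ⟨l₁, l₂, rfl⟩ := List.append_of_mem hd
  rw [List.map_append, List.nodup_append'] at hnd
  obtain ⟨-, hnd2, hdisj⟩ := hnd
  have hne1 : ∀ z ∈ l₁, s(a z, b z) ≠ s(a d, b d) := fun z hz hzd =>
    hdisj (List.mem_map.2 ⟨z, hz, hzd⟩) (by simp)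
  have hne2 : ∀ z ∈ l₂, s(a z, b z) ≠ s(a d, b d) := fun z hz hzd => by
    rw [List.map_cons, List.nodup_cons] at hnd2
    exact hnd2.1 (List.mem_map.2 ⟨z, hz, hzd⟩)
  have hc' : (x :: (l₁ ++ d :: (l₂ ++ [y]))).IsChain R := by simpa using hc
  rw [← List.cons_append, List.isChain_split] at hc'
  have h1 := hS.joinedAvoiding_of_isChain d l₁ hne1 x d hc'.1
  have h2 := hS.joinedAvoiding_of_isChain d l₂ hne2 d y hc'.2
  rw [← hxy] at h2
  have h3 := hg.lt_of_joinedAvoiding (hS.adj d) (h2.trans h1)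
  have h4 := hS.sum_cost_le d (l₁ ++ l₂) (fun z hz => hmax z ?_) hε.le (m := 2 * k - 1) ?_
  · rw [hm, List.map_append, List.sum_append] at h4
    have h5 : 0 ≤ (k - 2 : ℝ) * (ε * w s(a d, b d)) := mul_nonneg (by linarith) (by positivity)
    nlinarith
  · simp at hz ⊢
    tauto
  · simp at hlen ⊢
    omega

/-- A hop system admits no short closed walks. -/
lemma noShortClosedWalk {N : Type*} {src tgt : D → N} {inv : D → D}
    (hS : HopSystem H T w k ε (fun x y => tgt x = src y) a b h) (hk : 2 ≤ k) (hε : 0 < ε)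
    (hg : WeightedGirthGT H w ((2 * (k : ℝ) - 1) * (1 + ε) + 1))
    (hh : ∀ x y, s(a x, b x) = s(a y, b y) → h x = h y)
    (hinv : ∀ x y, a x = b y → b x = a y → tgt x = src y → y = inv x) :
    NoShortClosedWalk src tgt inv (2 * k) := by
  intro x l hlen hchain hclosed
  have hchain' : (x :: l).IsChain fun x y => tgt x = src y := hchain.imp fun _ _ h => h.1
  by_cases hnd : ((x :: l).map fun z => s(a z, b z)).Nodup
  · refine hS.chain_false_of_start_eq hk hε hg x x l ?_ rfl rfl hnd (by simpa using hlen)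
    rw [← List.cons_append, List.isChain_append]
    refine ⟨hchain', by simp, ?_⟩
    intro p hp q hq
    rw [List.getLast?_eq_getLast_of_ne_nil (by simp)] at hp
    simp only [Option.mem_def, Option.some.injEq, List.head?_cons] at hp hq
    rw [← hp, ← hq, hclosed]
  · obtain ⟨l₁, p, m, q, l₃, heq, hpq, hnd'⟩ := exists_append_of_not_nodup_map _ _ hnd
    rw [heq] at hchain hchain' hlen
    have hlen' : m.length + 2 ≤ 2 * k := by
      simp at hlen
      omega
    have heq' : l₁ ++ p :: (m ++ q :: l₃) = l₁ ++ (p :: (m ++ [q])) ++ l₃ := by simp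
    rw [heq'] at hchain hchain'
    have hc := (List.isChain_append.1 (List.isChain_append.1 hchain).1).2.1
    have hc' := (List.isChain_append.1 (List.isChain_append.1 hchain').1).2.1
    rcases Sym2.eq_iff.1 hpq with ⟨h1, -⟩ | ⟨h1, h2⟩
    · exact hS.chain_false_of_start_eq hk hε hg p q m hc' h1 (hh _ _ hpq.symm) hnd' (by omega)
    · by_cases hm : m = []
      · subst hm
        have h3 : NonBacktracking src tgt inv p q := by simpa using hc
        exact h3.2 (hinv p q h1 h2 h3.1)
      · refine hS.chain_false_of_end_eq_start hk hε hg p q m hc' h2 hm ?_ (by omega)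
        rw [List.map_cons, List.nodup_cons] at hnd'
        exact hnd'.2

end HopSystem

end Chains

section BandGraph

variable {V : Type} {H T : SimpleGraph V} {w : Sym2 V → NNReal}

/-- The edges of `H` outside `T` whose weight lies in `[x, y)`. -/
def bandGraph (H T : SimpleGraph V) (w : Sym2 V → NNReal) (x y : ℝ) : SimpleGraph V where
  Adj u v := H.Adj u v ∧ ¬ T.Adj u v ∧ x ≤ w s(u, v) ∧ w s(u, v) < y
  symm := ⟨fun u v h => by
    rw [Sym2.eq_swap, H.adj_comm, T.adj_comm]
    exact h⟩
  loopless := ⟨fun u h => H.loopless.irrefl u h.1⟩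

lemma bandGraph_le (x y : ℝ) : bandGraph H T w x y ≤ H := fun _ _ h => h.1

lemma disjoint_bandGraph (x y : ℝ) : Disjoint (bandGraph H T w x y) T :=
  SimpleGraph.disjoint_left.2 fun _ _ h => h.2.1

lemma mem_bandGraph_bounds {x y : ℝ} {e : Sym2 V} (he : e ∈ (bandGraph H T w x y).edgeSet) :
    x ≤ w e ∧ w e < y := by
  induction e with
  | _ u v => exact he.2.2

lemma bandGraph_le_sup (x y z : ℝ) :
    bandGraph H T w x z ≤ bandGraph H T w x y ⊔ bandGraph H T w y z := by
  intro u v h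
  rcases lt_or_ge (w s(u, v) : ℝ) y with h1 | h1
  · exact Or.inl ⟨h.1, h.2.1, h.2.2.1, h1⟩
  · exact Or.inr ⟨h.1, h.2.1, h1, h.2.2.2⟩

end BandGraph

section Bands

variable {V : Type} [Fintype V] {H T : SimpleGraph V} {w : Sym2 V → NNReal}

lemma totalWeight_nonneg (G : SimpleGraph V) : 0 ≤ totalWeight G w :=
  Finset.sum_nonneg fun _ _ => by positivity

lemma totalWeight_le_add {G G₁ G₂ : SimpleGraph V} (hG : G ≤ G₁ ⊔ G₂) :
    totalWeight G w ≤ totalWeight G₁ w + totalWeight G₂ w := by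
  classical
  unfold totalWeight
  rw [← Finset.sum_union_inter]
  refine le_trans ?_ (le_add_of_nonneg_right (Finset.sum_nonneg fun _ _ => by positivity))
  refine Finset.sum_le_sum_of_subset_of_nonneg ?_ fun _ _ _ => by positivity
  intro e he
  have h1 := edgeSet_mono hG
  rw [edgeSet_sup] at h1
  simpa using h1 (by simpa using he)

lemma le_totalWeight {G : SimpleGraph V} {e : Sym2 V} (he : e ∈ G.edgeSet) :
    (w e : ℝ) ≤ totalWeight G w :=
  Finset.single_le_sum (f := fun e => (w e : ℝ)) (fun _ _ => by positivity) (by simpa using he)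

/-- If every edge `e` of `G` is replaced by `j e` parallel copies between
cells, shifted along the line on which `c` places the vertices, then the resulting multigraph
satisfies the Moore bound. -/
lemma sum_copies_le {G : SimpleGraph V} {k : ℕ} {ε : ℝ} (hk : 2 ≤ k) (hε : 0 < ε)
    (hg : WeightedGirthGT H w ((2 * (k : ℝ) - 1) * (1 + ε) + 1)) (hTH : T ≤ H)
    (hGH : G ≤ H) (hGT : Disjoint G T) (c : V → ℕ) (j : Sym2 V → ℕ) (h : Sym2 V → ℝ) (N : ℕ)
    (hN : ∀ e ∈ G.edgeSet, ∀ s < j e, ∀ a, c a + s < N)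
    (hself : ∀ e ∈ G.edgeSet, h e ≤ ε / 4 * w e)
    (hother : ∀ e ∈ G.edgeSet, ∀ e' ∈ G.edgeSet, h e ≤ k * ε / 4 * w e')
    (hwalk : ∀ e ∈ G.edgeSet, ∀ e' ∈ G.edgeSet, ∀ s < j e, ∀ s' < j e', ∀ a b,
      c a + s = c b + s' → ∃ p : T.Walk a b, walkWeight w p ≤ h e + h e') :
    ∑ e ∈ G.edgeSet.toFinite.toFinset, (j e : ℝ) ≤
      (1 + (N : ℝ) ^ ((1 : ℝ) / (k : ℝ))) * N := by
  classical
  let D := Σ d : G.Dart, Fin (j d.edge)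
  let src : D → Fin N := fun x => ⟨c x.1.fst + x.2, hN _ x.1.edge_mem _ x.2.2 _⟩
  let tgt : D → Fin N := fun x => ⟨c x.1.snd + x.2, hN _ x.1.edge_mem _ x.2.2 _⟩
  let inv : D → D := fun x => ⟨x.1.symm, ⟨x.2, by rw [Dart.edge_symm]; exact x.2.2⟩⟩
  have hS : HopSystem H T w k ε (fun x y : D => tgt x = src y) (fun x => x.1.fst)
      (fun x => x.1.snd) (fun x => h x.1.edge) :=
    { le := hTH
      adj := fun x => hGH x.1.adj
      not_adj := fun x hx => (SimpleGraph.disjoint_left.1 hGT) _ _ x.1.adj hx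
      le_self := fun x => hself _ x.1.edge_mem
      le_other := fun x y => hother _ x.1.edge_mem _ y.1.edge_mem
      exists_walk := fun x y hxy => hwalk _ x.1.edge_mem _ y.1.edge_mem _ x.2.2 _ y.2.2 _ _
        (Fin.mk.inj_iff.1 hxy) }
  have hns : NoShortClosedWalk src tgt inv (2 * k) := by
    refine hS.noShortClosedWalk hk hε hg ?_ ?_
    · intro x y hxy
      exact congrArg h hxy
    · rintro ⟨d, s⟩ ⟨d', s'⟩ h1 h2 h3
      obtain rfl : d' = d.symm := by
        ext
        · exact h2.symm
        · exact h1.symm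
      have h4 : c d.snd + (s : ℕ) = c d.snd + (s' : ℕ) := Fin.mk.inj_iff.1 h3
      have h5 : (s' : ℕ) = s := by omega
      simp only [inv]
      congr 1
      exact Fin.ext h5
  have hmoore := card_darts_le (D := D) (src := src) (tgt := tgt) (inv := inv) (fun _ => rfl)
    (fun _ => rfl) (by omega) hns
  have hcard : Fintype.card D = 2 * ∑ e ∈ G.edgeSet.toFinite.toFinset, j e := by
    rw [Fintype.card_sigma]
    simp only [Fintype.card_fin]
    rw [← Finset.sum_fiberwise_of_maps_to (g := fun d : G.Dart => d.edge)
      (t := G.edgeSet.toFinite.toFinset) (fun d _ => by simp), Finset.mul_sum]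
    refine Finset.sum_congr rfl fun e he => ?_
    have h1 : (Finset.univ.filter fun d : G.Dart => d.edge = e).card = 2 :=
      G.dart_edge_fiber_card e (by simpa using he)
    rw [Finset.sum_congr rfl (g := fun _ => j e)
      (fun d hd => by rw [(Finset.mem_filter.1 hd).2]), Finset.sum_const, h1, smul_eq_mul]
  rw [hcard, Fintype.card_fin] at hmoore
  push_cast at hmoore
  linarith

lemma lt_two_mul_totalWeight {γ : ℝ} (hg : WeightedGirthGT H w (γ + 1)) (hTH : T ≤ H)
    (hT : T.Connected) {u v : V} (huv : H.Adj u v) (hnot : ¬ T.Adj u v) :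
    γ * w s(u, v) < 2 * totalWeight T w := by
  obtain ⟨f, hf, hwalk⟩ := exists_line_embedding (w := w) hT
  obtain ⟨p, hp⟩ := hwalk v u
  have h1 := hg.lt_of_joinedAvoiding huv (.of_walk hTH hnot p hp)
  have h2 := hf u
  have h3 := hf v
  have h4 : |f v - f u| ≤ 2 * totalWeight T w := abs_le.2 ⟨by linarith, by linarith⟩
  linarith

lemma totalWeight_bandGraph_zero_le {k : ℕ} {ε : ℝ} (hk : 2 ≤ k) (hε : 0 < ε)
    (hg : WeightedGirthGT H w ((2 * (k : ℝ) - 1) * (1 + ε) + 1)) (hTH : T ≤ H) {W : ℝ}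
    (hW : 0 ≤ W) :
    totalWeight (bandGraph H T w 0 W) w ≤
      W * ((1 + (Fintype.card V : ℝ) ^ ((1 : ℝ) / (k : ℝ))) * Fintype.card V) := by
  have h1 := sum_copies_le hk hε hg hTH (bandGraph_le (w := w) 0 W)
    (disjoint_bandGraph 0 W)
    (fun v => Fintype.equivFin V v) (fun _ => 1) (fun _ => 0) (Fintype.card V)
    (by
      intro e _ s hs a
      have := (Fintype.equivFin V a).2
      omega)
    (fun _ _ => by positivity) (fun _ _ _ _ => by positivity)
    (by
      intro e _ e' _ s hs s' hs' a b hab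
      obtain rfl : a = b := (Fintype.equivFin V).injective (Fin.ext (by omega))
      exact ⟨Walk.nil, by simp [walkWeight]⟩)
  refine le_trans ?_ (mul_le_mul_of_nonneg_left h1 hW)
  rw [Finset.mul_sum]
  refine Finset.sum_le_sum fun e he => ?_
  have := (mem_bandGraph_bounds (w := w) (by simpa using he)).2
  push_cast
  linarith

lemma totalWeight_bandGraph_le {k : ℕ} {ε : ℝ} (hk : 2 ≤ k) (hε : 0 < ε)
    (hg : WeightedGirthGT H w ((2 * (k : ℝ) - 1) * (1 + ε) + 1)) (hTH : T ≤ H)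
    (hT : T.Connected) {W : ℝ} (hW : 0 < W) :
    totalWeight (bandGraph H T w W (k * W)) w ≤ 96 * (totalWeight T w / ε) *
      (24 * totalWeight T w / (ε * W)) ^ ((1 : ℝ) / (k : ℝ)) := by
  have hk' : (2 : ℝ) ≤ k := by exact_mod_cast hk
  set L := totalWeight T w with hL
  have hL0 : 0 ≤ L := totalWeight_nonneg T
  by_cases hne : (bandGraph H T w W (k * W)).edgeSet = ∅
  · have : totalWeight (bandGraph H T w W (k * W)) w = 0 := by simp [totalWeight, hne]
    rw [this]
    positivity
  have hsmall : ∀ e ∈ (bandGraph H T w W (k * W)).edgeSet, 3 * (ε * w e) ≤ 2 * L := by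
    intro e he
    induction e with
    | _ u v =>
      have h1 := lt_two_mul_totalWeight hg hTH hT he.1 he.2.1
      have h2 : (0 : ℝ) ≤ w s(u, v) := by positivity
      have h3 : 0 ≤ (2 * k - 4 : ℝ) * (ε * w s(u, v)) := mul_nonneg (by linarith) (by positivity)
      have h4 : 0 ≤ (2 * k - 1 : ℝ) * w s(u, v) := mul_nonneg (by linarith) (by positivity)
      rw [← hL] at h1
      linarith
  obtain ⟨e₀, he₀⟩ := Set.nonempty_iff_ne_empty.2 hne
  have hWL : 3 * (ε * W) ≤ 2 * L := by
    have h1 := hsmall e₀ he₀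
    have h2 := mul_le_mul_of_nonneg_left (mem_bandGraph_bounds he₀).1 hε.le
    linarith
  obtain ⟨f, hf, hwalk⟩ := exists_line_embedding (w := w) hT
  rw [← hL] at hf
  set δ : ℝ := ε * W / 4 with hδ
  have hδ0 : 0 < δ := by positivity
  have hj : ∀ e : Sym2 V, (⌊(w e : ℝ) / W⌋₊ : ℝ) * δ ≤ ε / 4 * w e := by
    intro e
    have h1 : (⌊(w e : ℝ) / W⌋₊ : ℝ) ≤ w e / W := Nat.floor_le (by positivity)
    rw [le_div_iff₀ hW] at h1
    rw [hδ]
    nlinarith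
  have h1 := sum_copies_le hk hε hg hTH (bandGraph_le (w := w) W (k * W))
    (disjoint_bandGraph W (k * W))
    (fun v => ⌊f v / δ⌋₊) (fun e => ⌊(w e : ℝ) / W⌋₊) (fun e => (⌊(w e : ℝ) / W⌋₊ : ℝ) * δ)
    (⌊3 * L / δ⌋₊ + 1)
    (by
      intro e he s hs a
      rw [Nat.lt_succ_iff]
      refine Nat.le_floor ?_
      push_cast
      have h2 : (⌊f a / δ⌋₊ : ℝ) ≤ f a / δ := Nat.floor_le (div_nonneg (hf a).1 hδ0.le)
      rw [le_div_iff₀ hδ0] at h2 ⊢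
      have h3 : (s : ℝ) ≤ ⌊(w e : ℝ) / W⌋₊ := by exact_mod_cast hs.le
      have h4 := mul_le_mul_of_nonneg_right h3 hδ0.le
      have h5 := hj e
      have h6 := hsmall e he
      have h7 := (hf a).2
      linarith)
    (fun e _ => hj e)
    (by
      intro e he e' he'
      have h2 := mem_bandGraph_bounds he
      have h3 := mem_bandGraph_bounds he'
      have h4 := hj e
      have h5 : ε / 4 * (w e : ℝ) ≤ ε / 4 * (k * W) :=
        mul_le_mul_of_nonneg_left h2.2.le (by positivity)
      have h6 : k * ε / 4 * W ≤ k * ε / 4 * (w e' : ℝ) :=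
        mul_le_mul_of_nonneg_left h3.1 (by positivity)
      linarith)
    (by
      intro e _ e' _ s hs s' hs' a b hab
      obtain ⟨p, hp⟩ := hwalk a b
      refine ⟨p, hp.trans ?_⟩
      have ha1 : (⌊f a / δ⌋₊ : ℝ) ≤ f a / δ := Nat.floor_le (div_nonneg (hf a).1 hδ0.le)
      have hb1 : (⌊f b / δ⌋₊ : ℝ) ≤ f b / δ := Nat.floor_le (div_nonneg (hf b).1 hδ0.le)
      have ha2 := Nat.lt_floor_add_one (f a / δ)
      have hb2 := Nat.lt_floor_add_one (f b / δ)
      rw [le_div_iff₀ hδ0] at ha1 hb1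
      rw [div_lt_iff₀ hδ0] at ha2 hb2
      have hs1 : (s : ℝ) + 1 ≤ ⌊(w e : ℝ) / W⌋₊ := by exact_mod_cast hs
      have hs2 : (s' : ℝ) + 1 ≤ ⌊(w e' : ℝ) / W⌋₊ := by exact_mod_cast hs'
      have hab' : (⌊f a / δ⌋₊ : ℝ) + s = ⌊f b / δ⌋₊ + s' := by exact_mod_cast hab
      have hs3 := mul_le_mul_of_nonneg_right hs1 hδ0.le
      have hs4 := mul_le_mul_of_nonneg_right hs2 hδ0.le
      have hab2 : ((⌊f a / δ⌋₊ : ℝ) + s) * δ = (⌊f b / δ⌋₊ + s') * δ := by rw [hab']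
      have hs5 : 0 ≤ (s : ℝ) * δ := by positivity
      have hs6 : 0 ≤ (s' : ℝ) * δ := by positivity
      exact abs_le.2 ⟨by linarith, by linarith⟩)
  set y : ℝ := 24 * L / (ε * W) with hy
  have hN : ((⌊3 * L / δ⌋₊ + 1 : ℕ) : ℝ) ≤ y := by
    have h2 : (⌊3 * L / δ⌋₊ : ℝ) ≤ 3 * L / δ := Nat.floor_le (by positivity)
    have h3 : 3 * L / δ = 12 * L / (ε * W) := by
      rw [hδ]
      field_simp
      ring
    have h4 : 1 ≤ 12 * L / (ε * W) := by
      rw [le_div_iff₀ (by positivity)]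
      linarith
    have h5 : y = 2 * (12 * L / (ε * W)) := by
      rw [hy]
      ring
    push_cast
    linarith
  have hN1 : (1 : ℝ) ≤ ((⌊3 * L / δ⌋₊ + 1 : ℕ) : ℝ) := by
    push_cast
    linarith [Nat.cast_nonneg (α := ℝ) ⌊3 * L / δ⌋₊]
  set N : ℝ := ((⌊3 * L / δ⌋₊ + 1 : ℕ) : ℝ)
  have hNk : 1 ≤ N ^ ((1 : ℝ) / (k : ℝ)) := Real.one_le_rpow hN1 (by positivity)
  have hNy : N ^ ((1 : ℝ) / (k : ℝ)) ≤ y ^ ((1 : ℝ) / (k : ℝ)) :=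
    Real.rpow_le_rpow (by linarith) hN (by positivity)
  have h2 : totalWeight (bandGraph H T w W (k * W)) w ≤
      2 * W * ∑ e ∈ (bandGraph H T w W (k * W)).edgeSet.toFinite.toFinset,
        (⌊(w e : ℝ) / W⌋₊ : ℝ) := by
    rw [Finset.mul_sum]
    refine Finset.sum_le_sum fun e he => ?_
    have h3 := (mem_bandGraph_bounds (w := w) (e := e) (by simpa using he)).1
    have h4 : 1 ≤ ⌊(w e : ℝ) / W⌋₊ := by
      refine Nat.le_floor ?_
      rw [Nat.cast_one, le_div_iff₀ hW]
      linarith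
    have h5 : (1 : ℝ) ≤ ⌊(w e : ℝ) / W⌋₊ := by exact_mod_cast h4
    have h6 := Nat.lt_floor_add_one ((w e : ℝ) / W)
    rw [div_lt_iff₀ hW] at h6
    nlinarith
  calc totalWeight (bandGraph H T w W (k * W)) w
      ≤ 2 * W * ((1 + N ^ ((1 : ℝ) / (k : ℝ))) * N) :=
        h2.trans (mul_le_mul_of_nonneg_left h1 (by positivity))
    _ ≤ 2 * W * ((2 * y ^ ((1 : ℝ) / (k : ℝ))) * y) := by
        have : 0 ≤ y := by linarith
        gcongr
        linarith
    _ = 96 * (L / ε) * y ^ ((1 : ℝ) / (k : ℝ)) := by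
        rw [hy]
        field_simp
        ring

lemma totalWeight_bandGraph_pow_le {k : ℕ} {ε : ℝ} (hk : 2 ≤ k) (hε : 0 < ε)
    (hg : WeightedGirthGT H w ((2 * (k : ℝ) - 1) * (1 + ε) + 1)) (hTH : T ≤ H)
    (hT : T.Connected) (hL : 0 < totalWeight T w) (M : ℕ) :
    totalWeight (bandGraph H T w 0 (totalWeight T w / Fintype.card V * k ^ M)) w ≤
      totalWeight T w * (1 + (Fintype.card V : ℝ) ^ ((1 : ℝ) / (k : ℝ))) +
      2304 * totalWeight T w * (Fintype.card V : ℝ) ^ ((1 : ℝ) / (k : ℝ)) /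
        ε ^ ((1 : ℝ) + 1 / (k : ℝ)) *
        ∑ i ∈ Finset.range M, ((k : ℝ) ^ (-((1 : ℝ) / (k : ℝ)))) ^ i := by
  have : Nonempty V := hT.nonempty
  have hn : (0 : ℝ) < Fintype.card V := by exact_mod_cast Fintype.card_pos
  have hk0 : (0 : ℝ) < k := by positivity
  set L := totalWeight T w
  set n : ℝ := (Fintype.card V : ℝ)
  induction M with
  | zero =>
    refine (totalWeight_bandGraph_zero_le hk hε hg hTH (by positivity)).trans (le_of_eq ?_)
    simp only [pow_zero, mul_one, Finset.range_zero, Finset.sum_empty, mul_zero, add_zero]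
    change L / n * ((1 + n ^ _) * n) = _
    field_simp
  | succ M ih =>
    have h1 := totalWeight_le_add (w := w)
      (bandGraph_le_sup (H := H) (T := T) (w := w) 0 (L / n * k ^ M) (L / n * k ^ (M + 1)))
    have h2 := totalWeight_bandGraph_le hk hε hg hTH hT (W := L / n * k ^ M) (by positivity)
    have h3 : (k : ℝ) * (L / n * k ^ M) = L / n * k ^ (M + 1) := by ring
    rw [h3] at h2
    have h4 : 96 * (L / ε) * (24 * L / (ε * (L / n * k ^ M))) ^ ((1 : ℝ) / (k : ℝ)) ≤
        2304 * L * n ^ ((1 : ℝ) / (k : ℝ)) / ε ^ ((1 : ℝ) + 1 / (k : ℝ)) *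
          ((k : ℝ) ^ (-((1 : ℝ) / (k : ℝ)))) ^ M := by
      have h5 : 24 * L / (ε * (L / n * k ^ M)) = 24 * n / ε * ((k : ℝ) ^ M)⁻¹ := by
        field_simp
      rw [h5, Real.mul_rpow (by positivity) (by positivity),
        Real.div_rpow (by positivity) (by positivity), Real.mul_rpow (by positivity) hn.le,
        Real.rpow_add hε, Real.rpow_one]
      have h6 : (((k : ℝ) ^ M)⁻¹) ^ ((1 : ℝ) / (k : ℝ)) =
          ((k : ℝ) ^ (-((1 : ℝ) / (k : ℝ)))) ^ M := by
        rw [Real.inv_rpow (by positivity), Real.rpow_neg hk0.le, inv_pow, ← Real.rpow_natCast,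
          ← Real.rpow_natCast, ← Real.rpow_mul hk0.le, ← Real.rpow_mul hk0.le, mul_comm]
      rw [h6]
      have h7 : (24 : ℝ) ^ ((1 : ℝ) / (k : ℝ)) ≤ 24 := by
        conv_rhs => rw [← Real.rpow_one 24]
        refine Real.rpow_le_rpow_of_exponent_le (by norm_num) ?_
        rw [div_le_one hk0]
        exact_mod_cast (by omega : 1 ≤ k)
      calc 96 * (L / ε) * (24 ^ ((1 : ℝ) / (k : ℝ)) * n ^ ((1 : ℝ) / (k : ℝ)) /
            ε ^ ((1 : ℝ) / (k : ℝ)) * ((k : ℝ) ^ (-((1 : ℝ) / (k : ℝ)))) ^ M)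
          ≤ 96 * (L / ε) * (24 * n ^ ((1 : ℝ) / (k : ℝ)) /
            ε ^ ((1 : ℝ) / (k : ℝ)) * ((k : ℝ) ^ (-((1 : ℝ) / (k : ℝ)))) ^ M) := by gcongr
        _ = _ := by
          field_simp
          norm_num
    rw [Finset.sum_range_succ, mul_add]
    linarith

end Bands

lemma geom_sum_rpow_neg_inv_le {k : ℕ} (hk : 2 ≤ k) (M : ℕ) :
    ∑ i ∈ Finset.range M, ((k : ℝ) ^ (-((1 : ℝ) / (k : ℝ)))) ^ i ≤
      4 * ((k : ℝ) / Real.logb 2 k) := by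
  have hk' : (2 : ℝ) ≤ k := by exact_mod_cast hk
  have hk0 : (0 : ℝ) < k := by linarith
  have hlog : 0 < Real.log k := Real.log_pos (by linarith)
  have hlogk : Real.log k ≤ k := (Real.log_le_sub_one_of_pos hk0).trans (by linarith)
  set x : ℝ := Real.log k / k with hx
  have hx0 : 0 < x := by positivity
  have hx1 : x ≤ 1 := (div_le_one hk0).2 hlogk
  set q : ℝ := (k : ℝ) ^ (-((1 : ℝ) / (k : ℝ))) with hq
  have hq0 : 0 < q := by positivity
  have hqx : q = (Real.exp x)⁻¹ := by
    rw [hq, Real.rpow_def_of_pos hk0, ← Real.exp_neg]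
    congr 1
    rw [hx]
    ring
  have hqle : q ≤ (1 + x)⁻¹ := by
    rw [hqx]
    exact inv_anti₀ (by positivity) (by linarith [Real.add_one_le_exp x])
  have h1q : x / 2 ≤ 1 - q := by
    have : (1 + x)⁻¹ ≤ 1 - x / 2 := by
      rw [inv_le_iff_one_le_mul₀ (by positivity)]
      nlinarith
    linarith
  have hpos : 0 < 1 - q := by linarith [half_pos hx0]
  have hsum : ∑ i ∈ Finset.range M, q ^ i ≤ 1 / (1 - q) := by
    rw [le_div_iff₀ hpos]
    have := geom_sum_mul_neg q M
    rw [this]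
    linarith [pow_pos hq0 M]
  have h2 : 1 / (1 - q) ≤ 2 * (k / Real.log k) := by
    have h3 : 2 * (k / Real.log k) = 1 / (x / 2) := by
      rw [hx]
      field_simp
    rw [h3]
    exact one_div_le_one_div_of_le (by positivity) h1q
  have h4 : (k : ℝ) / Real.logb 2 k = k / Real.log k * Real.log 2 := by
    rw [Real.logb]
    field_simp
  have h5 : 0 < (k : ℝ) / Real.log k := by positivity
  have h6 := Real.log_two_gt_d9
  rw [h4]
  nlinarith

lemma totalWeight_le_of_connected {V : Type} [Fintype V] {H T : SimpleGraph V}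
    {w : Sym2 V → NNReal} {k : ℕ} {ε : ℝ} (hk : 2 ≤ k) (hε : 0 < ε)
    (hpos : ∀ e ∈ H.edgeSet, 0 < w e)
    (hg : WeightedGirthGT H w ((2 * (k : ℝ) - 1) * (1 + ε) + 1)) (hTH : T ≤ H)
    (hT : T.Connected) :
    totalWeight H w ≤ 10000 * totalWeight T w * (Fintype.card V : ℝ) ^ ((1 : ℝ) / (k : ℝ)) *
      (1 + (k : ℝ) / (ε ^ ((1 : ℝ) + 1 / (k : ℝ)) * Real.logb 2 (k : ℝ))) := by
  have : Nonempty V := hT.nonempty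
  have hk' : (2 : ℝ) ≤ k := by exact_mod_cast hk
  have hlog : 0 < Real.logb 2 k := Real.logb_pos (by norm_num) (by linarith)
  have hn : (1 : ℝ) ≤ Fintype.card V := by exact_mod_cast Fintype.card_pos (α := V)
  have hr : 1 ≤ (Fintype.card V : ℝ) ^ ((1 : ℝ) / (k : ℝ)) := Real.one_le_rpow hn (by positivity)
  set L := totalWeight T w with hL
  set r := (Fintype.card V : ℝ) ^ ((1 : ℝ) / (k : ℝ))
  set K : ℝ := (k : ℝ) / (ε ^ ((1 : ℝ) + 1 / (k : ℝ)) * Real.logb 2 (k : ℝ)) with hK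
  have hL0 : 0 ≤ L := totalWeight_nonneg T
  have hK0 : 0 ≤ K := by positivity
  have hLr : L ≤ L * r := le_mul_of_one_le_right hL0 hr
  have hLrK : 0 ≤ L * r * K := by positivity
  by_cases hne : ∃ u v, H.Adj u v ∧ ¬ T.Adj u v
  · obtain ⟨u, v, huv, hnot⟩ := hne
    have hLpos : 0 < L := by
      have h1 := lt_two_mul_totalWeight hg hTH hT huv hnot
      have h2 : (0 : ℝ) < w s(u, v) := hpos _ huv
      have h3 : 0 < (2 * (k : ℝ) - 1) * (1 + ε) * w s(u, v) :=
        mul_pos (mul_pos (by linarith) (by linarith)) h2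
      linarith
    obtain ⟨M, hM⟩ := pow_unbounded_of_one_lt (totalWeight H w / (L / Fintype.card V))
      (by linarith : (1 : ℝ) < k)
    rw [div_lt_iff₀ (by positivity), mul_comm] at hM
    have hsplit : H ≤ T ⊔ bandGraph H T w 0 (L / Fintype.card V * k ^ M) := by
      intro a b hab
      by_cases h : T.Adj a b
      · exact Or.inl h
      · exact Or.inr ⟨hab, h, by positivity,
          (le_totalWeight (w := w) (e := s(a, b)) hab).trans_lt hM⟩
    have h1 := totalWeight_le_add (w := w) hsplit
    have h2 := totalWeight_bandGraph_pow_le hk hε hg hTH hT hLpos M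
    have h3 : 2304 * L * r / ε ^ ((1 : ℝ) + 1 / (k : ℝ)) *
        ∑ i ∈ Finset.range M, ((k : ℝ) ^ (-((1 : ℝ) / (k : ℝ)))) ^ i ≤
        2304 * L * r / ε ^ ((1 : ℝ) + 1 / (k : ℝ)) * (4 * ((k : ℝ) / Real.logb 2 k)) :=
      mul_le_mul_of_nonneg_left (geom_sum_rpow_neg_inv_le hk M) (by positivity)
    have h4 : 2304 * L * r / ε ^ ((1 : ℝ) + 1 / (k : ℝ)) * (4 * ((k : ℝ) / Real.logb 2 k)) =
        9216 * (L * r * K) := by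
      rw [hK]
      field_simp
      norm_num
    linarith
  · push Not at hne
    have h1 : totalWeight H w = L := by rw [hL, le_antisymm hTH hne]
    rw [h1]
    linarith

/-- There is a universal constant `C > 0` such that for every integer `k ≥ 2`, every
`ε > 0` and every connected weighted graph `H` on `n` vertices whose weighted girth is
strictly greater than `(2k-1)(1+ε) + 1` (equivalently, every cycle `C` satisfies
`w(C) > ((2k-1)(1+ε)+1) · w(e)` for every edge `e ∈ C`), the total weight of `H` is at
most `C · w(MST(H)) · n^{1/k} · (1 + k/(ε^{1+1/k}·log k))`. -/
theorem weight_bound_of_large_weighted_girth :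
    ∃ C : ℝ, 0 < C ∧
      ∀ (k : ℕ), 2 ≤ k → ∀ (ε : ℝ), 0 < ε →
        ∀ (V : Type) [Fintype V] (H : SimpleGraph V) (w : Sym2 V → NNReal),
          H.Connected → (∀ e ∈ H.edgeSet, 0 < w e) →
          (∀ (v : V) (p : H.Walk v v), p.IsCycle → ∀ e ∈ p.edges,
            ((2 * (k : ℝ) - 1) * (1 + ε) + 1) * (w e : ℝ) <
              (p.edges.map fun e => (w e : ℝ)).sum) →
          totalWeight H w ≤
            C * mstWeight H w * (Fintype.card V : ℝ) ^ ((1 : ℝ) / (k : ℝ)) *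
              (1 + (k : ℝ) / (ε ^ ((1 : ℝ) + 1 / (k : ℝ)) * Real.logb 2 (k : ℝ))) := by
  refine ⟨10000, by norm_num, fun k hk ε hε V _ H w hconn hpos hg => ?_⟩
  have hk' : (2 : ℝ) ≤ k := by exact_mod_cast hk
  have hlog : 0 < Real.logb 2 k := Real.logb_pos (by norm_num) (by linarith)
  have : Nonempty V := hconn.nonempty
  have hn : (0 : ℝ) < Fintype.card V := by exact_mod_cast Fintype.card_pos (α := V)
  have hB : 0 < 10000 * (Fintype.card V : ℝ) ^ ((1 : ℝ) / (k : ℝ)) *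
      (1 + (k : ℝ) / (ε ^ ((1 : ℝ) + 1 / (k : ℝ)) * Real.logb 2 (k : ℝ))) := by positivity
  have hmst : totalWeight H w / (10000 * (Fintype.card V : ℝ) ^ ((1 : ℝ) / (k : ℝ)) *
      (1 + (k : ℝ) / (ε ^ ((1 : ℝ) + 1 / (k : ℝ)) * Real.logb 2 (k : ℝ)))) ≤ mstWeight H w := by
    refine le_csInf ?_ ?_
    · obtain ⟨T, hTH, hT⟩ := hconn.exists_isTree_le
      exact ⟨_, T, hTH, hT, rfl⟩
    · rintro x ⟨T, hTH, hT, rfl⟩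
      rw [div_le_iff₀ hB]
      refine (totalWeight_le_of_connected hk hε hpos hg hTH hT.connected).trans (le_of_eq ?_)
      ring
  rw [div_le_iff₀ hB] at hmst
  refine hmst.trans (le_of_eq ?_)
  ring
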